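/- arXiv:2411.12404 — 3 statements merged into one kernel-verified Lean document; each statement's English description precedes it below -/
import Mathlib

section
/- The Jacobson radical of the group algebra k[I] equals the two-sided ideal of k[I] generated by the elements g − 1 with g ∈ P; equivalently, it equals k[I]·I_P, where I_P denotes the augmentation ideal of k[P], and the quotient of k[I] by its Jacobson radical is isomorphic as a k-algebra to the group algebra k[I/P]. -/
/-- A finite `p`-group acting additively on a nontrivial abelian group of exponent `p` has a nonzero
fixed vector. -/
theorem IsPGroup.exists_ne_zero_forall_smul_eq {p : ℕ} [Fact p.Prime] {G : Type*} [Group G]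
    [Finite G] (hG : IsPGroup p G) {V : Type*} [AddCommGroup V] [Nontrivial V]
    [DistribMulAction G V] (hV : ∀ v : V, p • v = 0) :
    ∃ v : V, v ≠ 0 ∧ ∀ g : G, g • v = v := by
  obtain ⟨v, hv⟩ := exists_ne (0 : V)
  let N : AddSubgroup V := AddSubgroup.closure (Set.range fun g : G => g • v)
  have hvN : v ∈ N := AddSubgroup.subset_closure ⟨1, one_smul G v⟩
  have hN (g : G) (w : V) (hw : w ∈ N) : g • w ∈ N := by
    have hle : N ≤ N.comap (DistribSMul.toAddMonoidHom V g) := by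
      refine (AddSubgroup.closure_le _).2 ?_
      rintro _ ⟨h, rfl⟩
      exact AddSubgroup.subset_closure ⟨g * h, mul_smul g h v⟩
    exact hle hw
  let : MulAction G N :=
    { smul := fun g w => ⟨g • (w : V), hN g w w.2⟩
      one_smul := fun w => Subtype.ext (one_smul G (w : V))
      mul_smul := fun g h w => Subtype.ext (mul_smul g h (w : V)) }
  have hpN (w : N) : p • w = 0 := Subtype.ext (hV w)
  have : AddGroup.FG N := AddGroup.closure_finite_fg _
  have : Finite N := AddCommGroup.finite_of_fg_isAddTorsion N fun w =>
    isOfFinAddOrder_iff_nsmul_eq_zero.2 ⟨p, (Fact.out : p.Prime).pos, hpN w⟩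
  have hcard : p ∣ Nat.card N := by
    rw [← addOrderOf_eq_prime (hpN ⟨v, hvN⟩) fun h => hv (congrArg Subtype.val h)]
    exact addOrderOf_dvd_natCard _
  obtain ⟨b, hb, hb0⟩ := hG.exists_fixed_point_of_prime_dvd_card_of_fixed_point N hcard
    (a := 0) (fun g => Subtype.ext (smul_zero g))
  exact ⟨b, fun h => hb0 (Subtype.ext h.symm), fun g => congrArg Subtype.val (hb g)⟩

namespace MonoidAlgebra

variable {k G : Type*} [Field k] [Group G]

/-- A normal `p`-subgroup acts trivially on every simple module in characteristic `p`. -/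
theorem single_smul_eq_of_isSimpleModule {p : ℕ} [Fact p.Prime] [CharP k p] {P : Subgroup G}
    [P.Normal] [Finite P] (hP : IsPGroup p P) {V : Type*} [AddCommGroup V]
    [Module (MonoidAlgebra k G) V] [IsSimpleModule (MonoidAlgebra k G) V] {g : G} (hg : g ∈ P)
    (v : V) : single g (1 : k) • v = v := by
  let W : Submodule (MonoidAlgebra k G) V :=
    { carrier := {v | ∀ g ∈ P, single g (1 : k) • v = v}
      zero_mem' := fun g _ => smul_zero _
      add_mem' := fun ha hb g hg => by rw [smul_add, ha g hg, hb g hg]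
      smul_mem' := fun a v hv => by
        induction a using induction_linear with
        | zero => intro g _; simp
        | add a b ha hb => intro g hg; rw [add_smul, smul_add, ha g hg, hb g hg]
        | single h c =>
          intro g hg
          have hconj : h⁻¹ * g * h ∈ P := by
            simpa using Subgroup.Normal.conj_mem ‹P.Normal› g hg h⁻¹
          have hcomm : single g (1 : k) * single h c =
              single h c * single (h⁻¹ * g * h) (1 : k) := by
            simp [single_mul_single, mul_assoc]
          rw [← mul_smul, hcomm, mul_smul, hv _ hconj] }
  have hW : W = ⊤ := by
    refine (eq_bot_or_eq_top W).resolve_left fun hbot => ?_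
    let : DistribMulAction P V := DistribMulAction.compHom V ((of k G).comp P.subtype)
    have : Nontrivial V := IsSimpleModule.nontrivial (MonoidAlgebra k G) V
    have : CharP (MonoidAlgebra k G) p := charP_of_injective_algebraMap
      (algebraMap k (MonoidAlgebra k G)).injective p
    have hV (v : V) : p • v = 0 := by
      rw [← Nat.cast_smul_eq_nsmul (MonoidAlgebra k G), CharP.cast_eq_zero, zero_smul]
    obtain ⟨w, hw0, hw⟩ := hP.exists_ne_zero_forall_smul_eq hV
    have hwW : w ∈ W := fun g hg => hw ⟨g, hg⟩
    rw [hbot] at hwW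
    exact hw0 hwW
  have hv : v ∈ W := hW ▸ Submodule.mem_top
  exact hv g hg

/-- For a normal `p`-subgroup `P`, the elements `g - 1` with `g ∈ P` lie in the Jacobson radical. -/
theorem single_sub_one_mem_jacobson {p : ℕ} [Fact p.Prime] [CharP k p] {P : Subgroup G}
    [P.Normal] [Finite P] (hP : IsPGroup p P) {g : G} (hg : g ∈ P) :
    single g (1 : k) - 1 ∈ Ring.jacobson (MonoidAlgebra k G) := by
  rw [Ring.jacobson_eq_sInf_isMaximal, Submodule.mem_sInf]
  intro M hM
  have : IsSimpleModule (MonoidAlgebra k G) (MonoidAlgebra k G ⧸ M) :=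
    isSimpleModule_iff_isCoatom.2 (Ideal.isMaximal_def.1 hM)
  have h := single_smul_eq_of_isSimpleModule (k := k) hP hg
    (Submodule.Quotient.mk (p := M) 1)
  rw [← Submodule.Quotient.mk_smul, smul_eq_mul, mul_one] at h
  exact (Submodule.Quotient.eq M).1 h

theorem mapDomainAlgHom_mk'_surjective (P : Subgroup G) [P.Normal] :
    Function.Surjective
      (mapDomainAlgHom k k (QuotientGroup.mk' P) :
        MonoidAlgebra k G →ₐ[k] MonoidAlgebra k (G ⧸ P)) := by
  intro y
  induction y using induction_linear with
  | zero => exact ⟨0, map_zero _⟩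
  | add a b ha hb =>
    obtain ⟨x, rfl⟩ := ha
    obtain ⟨y, rfl⟩ := hb
    exact ⟨x + y, map_add _ _ _⟩
  | single q c =>
    obtain ⟨h, rfl⟩ := QuotientGroup.mk'_surjective P q
    exact ⟨single h c, by simp⟩

/-- The kernel of `k[G] → k[G ⧸ P]` is contained in the left ideal generated by the elements
`g - 1` with `g ∈ P`. -/
theorem ker_mapDomainAlgHom_mk'_le_span (P : Subgroup G) [P.Normal] :
    RingHom.ker
        (mapDomainAlgHom k k (QuotientGroup.mk' P) :
          MonoidAlgebra k G →ₐ[k] MonoidAlgebra k (G ⧸ P)) ≤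
      Ideal.span {x | ∃ g ∈ P, x = single g (1 : k) - 1} := by
  have key (x : MonoidAlgebra k G) :
      x - mapDomain Quotient.out (mapDomainAlgHom k k (QuotientGroup.mk' P) x) ∈
        Ideal.span {x | ∃ g ∈ P, x = single g (1 : k) - 1} := by
    induction x using induction_linear with
    | zero => simp
    | add a b ha hb =>
      rw [map_add, mapDomain_add, add_sub_add_comm]
      exact add_mem ha hb
    | single h c =>
      set t : G := (QuotientGroup.mk' P h).out with ht
      have hmem : t⁻¹ * h ∈ P := QuotientGroup.eq.1 (QuotientGroup.out_eq' (h : G ⧸ P))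
      have heq : single h c - mapDomain Quotient.out
          (mapDomainAlgHom k k (QuotientGroup.mk' P) (single h c)) =
          single t c * (single (t⁻¹ * h) (1 : k) - 1) := by
        rw [mul_sub, single_mul_single, mul_one, mul_one, mul_inv_cancel_left]
        simp [ht]
      rw [heq]
      exact Ideal.mul_mem_left _ _ (Ideal.subset_span ⟨_, hmem, rfl⟩)
  intro x hx
  have h := key x
  rwa [(RingHom.mem_ker).1 hx, mapDomain_zero, sub_zero] at h

end MonoidAlgebra

/- STATEMENT 7:
Let `k` be a field of characteristic `p > 0` and `I` a finite group possessing a normal Sylow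
`p`-subgroup `P`.  The Jacobson radical of the group algebra `k[I]` equals the two-sided ideal
of `k[I]` generated by the elements `g − 1` with `g ∈ P`; equivalently, it equals
`k[I] · I_P` (the left ideal generated by the augmentation ideal `I_P` of `k[P]`), and the
quotient of `k[I]` by its Jacobson radical is isomorphic as a `k`-algebra to the group algebra
`k[I/P]`.

The last clause is formalised, via the first isomorphism theorem, by the statement that
the canonical `k`-algebra map `k[I] → k[I/P]` is surjective with kernel the Jacobson radical. -/
theorem stmt7 (p : ℕ) [Fact (Nat.Prime p)] (k : Type) [Field k] [CharP k p]
    (I : Type) [Group I] [Finite I]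
    (P : Subgroup I) [P.Normal] (hPp : IsPGroup p P) (hPindex : ¬ p ∣ P.index) :
    -- the radical is the two-sided ideal generated by the `g − 1`, `g ∈ P`
    Ideal.jacobson (⊥ : Ideal (MonoidAlgebra k I)) =
      TwoSidedIdeal.asIdeal
        (TwoSidedIdeal.span {x | ∃ g ∈ P, x = MonoidAlgebra.single g (1 : k) - 1}) ∧
    -- equivalently, it is the left ideal `k[I] · I_P`
    Ideal.jacobson (⊥ : Ideal (MonoidAlgebra k I)) =
      Ideal.span {x | ∃ g ∈ P, x = MonoidAlgebra.single g (1 : k) - 1} ∧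
    -- `k[I] / rad ≅ k[I/P]` as `k`-algebras
    Function.Surjective
      (MonoidAlgebra.mapDomainAlgHom k k (QuotientGroup.mk' P) :
        MonoidAlgebra k I →ₐ[k] MonoidAlgebra k (I ⧸ P)) ∧
    RingHom.ker
        (MonoidAlgebra.mapDomainAlgHom k k (QuotientGroup.mk' P) :
          MonoidAlgebra k I →ₐ[k] MonoidAlgebra k (I ⧸ P)) =
      Ideal.jacobson (⊥ : Ideal (MonoidAlgebra k I)) := by
  have hsurj := MonoidAlgebra.mapDomainAlgHom_mk'_surjective (k := k) P
  set π := (MonoidAlgebra.mapDomainAlgHom k k (QuotientGroup.mk' P) :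
    MonoidAlgebra k I →ₐ[k] MonoidAlgebra k (I ⧸ P))
  set S : Set (MonoidAlgebra k I) := {x | ∃ g ∈ P, x = MonoidAlgebra.single g (1 : k) - 1}
  have hker_span : RingHom.ker π ≤ Ideal.span S :=
    MonoidAlgebra.ker_mapDomainAlgHom_mk'_le_span P
  have hspan_two : Ideal.span S ≤ TwoSidedIdeal.asIdeal (TwoSidedIdeal.span S) :=
    Ideal.span_le.2 TwoSidedIdeal.subset_span
  have htwo_ker : TwoSidedIdeal.asIdeal (TwoSidedIdeal.span S) ≤ RingHom.ker π := by
    have hle : TwoSidedIdeal.span S ≤ TwoSidedIdeal.ker π := by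
      refine TwoSidedIdeal.span_le.2 ?_
      rintro _ ⟨g, hg, rfl⟩
      have hg1 : (g : I ⧸ P) = 1 := (QuotientGroup.eq_one_iff g).2 hg
      refine (TwoSidedIdeal.mem_ker _).2 ?_
      rw [map_sub, map_one, sub_eq_zero]
      simp [π, hg1, MonoidAlgebra.one_def]
    exact fun x hx => (TwoSidedIdeal.mem_ker _).1 (hle hx)
  have hspan_jac : Ideal.span S ≤ Ring.jacobson (MonoidAlgebra k I) := by
    refine Ideal.span_le.2 ?_
    rintro _ ⟨g, hg, rfl⟩
    exact MonoidAlgebra.single_sub_one_mem_jacobson hPp hg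
  have hjac_ker : Ring.jacobson (MonoidAlgebra k I) ≤ RingHom.ker π := by
    have : NeZero (Nat.card (I ⧸ P) : k) := ⟨fun h => hPindex ((CharP.cast_eq_zero_iff k p _).1 h)⟩
    have : RingHomSurjective (π : MonoidAlgebra k I →+* MonoidAlgebra k (I ⧸ P)) := ⟨hsurj⟩
    intro x hx
    have h := Ring.le_comap_jacobson (π : MonoidAlgebra k I →+* MonoidAlgebra k (I ⧸ P)) hx
    rw [IsSemisimpleRing.jacobson_eq_bot] at h
    exact h
  have hjac : Ring.jacobson (MonoidAlgebra k I) = RingHom.ker π :=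
    le_antisymm hjac_ker (hker_span.trans hspan_jac)
  rw [Ideal.jacobson_bot, hjac]
  exact ⟨le_antisymm (hker_span.trans hspan_two) htwo_ker,
    le_antisymm hker_span (hspan_two.trans htwo_ker), hsurj, rfl⟩
end

section
/- dim_{k̄}( T^* ⊗_{𝔽_p[G]} M(j) ) = Σ_{a=0}^{f−1} dim_{k̄} T[θ^{j·p^a}], where T[θ^s] := {x ∈ T : c·x = θ(c)^s·x for all c ∈ C} is the θ^s-eigenspace of C on T, with θ(c) regarded as an element of k̄ via the inclusion k_w ⊆ k̄. -/
set_option maxSynthPendingDepth 3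

open scoped TensorProduct

/-- The action of a group element `g` on a module `T` over the group ring `R[G]`, as an
`R`-linear endomorphism of `T`. -/
noncomputable def grpSmul (R : Type) [CommRing R] (G : Type) [Group G] (T : Type)
    [AddCommGroup T] [Module R T] [Module (MonoidAlgebra R G) T]
    [IsScalarTower R (MonoidAlgebra R G) T] (g : G) : T →ₗ[R] T where
  toFun x := (MonoidAlgebra.single g (1 : R)) • x
  map_add' _ _ := smul_add _ _ _
  map_smul' a x := by
    simp only [RingHom.id_apply]
    rw [← algebraMap_smul (MonoidAlgebra R G) a x, smul_smul, ← Algebra.commutes a, mul_smul,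
      algebraMap_smul]

/-- The `𝔽_p[G]`-submodule of relations presenting the induced module
`M(j) = 𝔽_p[G] ⊗_{𝔽_p[C]} V_j`, where `V_j = k_w` with `c ∈ C` acting as `θ(c)^j`.
(As both factors are of characteristic `p`, tensoring over `𝔽_p = ZMod p` realises the
tensor product over the prime field.) -/
noncomputable def indRel (p : ℕ) [Fact (Nat.Prime p)]
    (kw : Type) [Field kw] [Algebra (ZMod p) kw]
    (G : Type) [Group G] (C : Subgroup G) (θ : ↥C →* kwˣ) (j : ℤ) :
    Submodule (MonoidAlgebra (ZMod p) G) (MonoidAlgebra (ZMod p) G ⊗[ZMod p] kw) :=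
  Submodule.span _
    {x | ∃ (u : MonoidAlgebra (ZMod p) G) (c : ↥C) (v : kw),
      x = (u * MonoidAlgebra.single (c : G) 1) ⊗ₜ[ZMod p] v
            - u ⊗ₜ[ZMod p] (((θ c ^ j : kwˣ) : kw) * v)}

/-- The induced `𝔽_p[G]`-module `M(j) := 𝔽_p[G] ⊗_{𝔽_p[C]} V_j`. -/
noncomputable abbrev inducedMj (p : ℕ) [Fact (Nat.Prime p)]
    (kw : Type) [Field kw] [Algebra (ZMod p) kw]
    (G : Type) [Group G] (C : Subgroup G) (θ : ↥C →* kwˣ) (j : ℤ) : Type :=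
  (MonoidAlgebra (ZMod p) G ⊗[ZMod p] kw) ⧸ indRel p kw G C θ j

/-- The relations defining the balanced tensor product `T^* ⊗_{𝔽_p[G]} M(j)`:
`(f·g) ⊗ m − f ⊗ (g·m)`, where `T^*` is a right `𝔽_p[G]`-module via the contragredient
action `f·g = f ∘ (g·)`. -/
noncomputable def balRel (p : ℕ) [Fact (Nat.Prime p)]
    (kw : Type) [Field kw] [Algebra (ZMod p) kw]
    (kbar : Type) [Field kbar] [Algebra (ZMod p) kbar]
    (G : Type) [Group G] (C : Subgroup G) (θ : ↥C →* kwˣ) (j : ℤ)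
    (T : Type) [AddCommGroup T] [Module kbar T] [Module (MonoidAlgebra kbar G) T]
    [IsScalarTower kbar (MonoidAlgebra kbar G) T] :
    Submodule kbar (Module.Dual kbar T ⊗[ZMod p] inducedMj p kw G C θ j) :=
  Submodule.span kbar
    {x | ∃ (fd : Module.Dual kbar T) (m : inducedMj p kw G C θ j) (g : G),
      x = (fd ∘ₗ grpSmul kbar G T g) ⊗ₜ[ZMod p] m
            - fd ⊗ₜ[ZMod p] ((MonoidAlgebra.single g (1 : ZMod p)) • m)}

/-- The balanced tensor product `T^* ⊗_{𝔽_p[G]} M(j)`, a `k̄`-vector space. -/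
noncomputable abbrev balTensor (p : ℕ) [Fact (Nat.Prime p)]
    (kw : Type) [Field kw] [Algebra (ZMod p) kw]
    (kbar : Type) [Field kbar] [Algebra (ZMod p) kbar]
    (G : Type) [Group G] (C : Subgroup G) (θ : ↥C →* kwˣ) (j : ℤ)
    (T : Type) [AddCommGroup T] [Module kbar T] [Module (MonoidAlgebra kbar G) T]
    [IsScalarTower kbar (MonoidAlgebra kbar G) T] : Type :=
  (Module.Dual kbar T ⊗[ZMod p] inducedMj p kw G C θ j) ⧸ balRel p kw kbar G C θ j T

/-- The `θ^s`-eigenspace `T[θ^s]` of `C` on `T`: the largest subspace on which every `c ∈ C`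
acts as multiplication by (the image in `k̄` of) `θ(c)^s`. -/
noncomputable def eigensp (kw : Type) [Field kw]
    (kbar : Type) [Field kbar] [Algebra kw kbar]
    (G : Type) [Group G] (C : Subgroup G) (θ : ↥C →* kwˣ) (s : ℤ)
    (T : Type) [AddCommGroup T] [Module kbar T] [Module (MonoidAlgebra kbar G) T]
    [IsScalarTower kbar (MonoidAlgebra kbar G) T] : Submodule kbar T where
  carrier := {x | ∀ c : ↥C,
    (MonoidAlgebra.single (c : G) (1 : kbar)) • x
      = (algebraMap kw kbar ((θ c ^ s : kwˣ) : kw)) • x}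
  zero_mem' := by intro c; simp
  add_mem' := by
    intro x y hx hy c
    rw [smul_add, hx c, hy c, smul_add]
  smul_mem' := by
    intro a x hx c
    have h : (MonoidAlgebra.single (c : G) (1 : kbar)) • (a • x)
        = a • ((MonoidAlgebra.single (c : G) (1 : kbar)) • x) :=
      (grpSmul kbar G T (c : G)).map_smul a x
    rw [h, hx c, smul_comm]


open Module

section BalancedDual

variable {p : ℕ} [Fact (Nat.Prime p)]
  {kw : Type} [Field kw] [Algebra (ZMod p) kw]
  {kbar : Type} [Field kbar] [Algebra (ZMod p) kbar]
  {G : Type} [Group G] {C : Subgroup G} {θ : ↥C →* kwˣ} {j : ℤ}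
  {T : Type} [AddCommGroup T] [Module kbar T] [Module (MonoidAlgebra kbar G) T]
  [IsScalarTower kbar (MonoidAlgebra kbar G) T]

variable (p C θ j) in
/-- The class of `1 ⊗ v` in the induced module. -/
noncomputable def inducedMk : kw →ₗ[ZMod p] inducedMj p kw G C θ j :=
  (indRel p kw G C θ j).mkQ.restrictScalars (ZMod p) ∘ₗ
    TensorProduct.mk (ZMod p) (MonoidAlgebra (ZMod p) G) kw 1

lemma single_smul_inducedMk (c : ↥C) (v : kw) :
    MonoidAlgebra.single (c : G) (1 : ZMod p) • inducedMk p C θ j v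
      = inducedMk p C θ j (((θ c ^ j : kwˣ) : kw) * v) := by
  change (indRel p kw G C θ j).mkQ (MonoidAlgebra.single (c : G) (1 : ZMod p) •
    ((1 : MonoidAlgebra (ZMod p) G) ⊗ₜ[ZMod p] v)) = (indRel p kw G C θ j).mkQ _
  rw [← sub_eq_zero, ← map_sub, Submodule.mkQ_apply, Submodule.Quotient.mk_eq_zero]
  refine Submodule.subset_span ⟨1, c, v, ?_⟩
  simp [TensorProduct.smul_tmul']

lemma mkQ_tmul (u : MonoidAlgebra (ZMod p) G) (v : kw) :
    (indRel p kw G C θ j).mkQ (u ⊗ₜ[ZMod p] v) = u • inducedMk p C θ j v := by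
  change _ = (indRel p kw G C θ j).mkQ (u • ((1 : MonoidAlgebra (ZMod p) G) ⊗ₜ[ZMod p] v))
  simp [TensorProduct.smul_tmul']

lemma inducedMj_hom_ext {N : Type} [AddCommGroup N] [Module (ZMod p) N]
    {φ ψ : inducedMj p kw G C θ j →ₗ[ZMod p] N}
    (h : ∀ (g : G) (v : kw), φ (MonoidAlgebra.single g (1 : ZMod p) • inducedMk p C θ j v)
      = ψ (MonoidAlgebra.single g (1 : ZMod p) • inducedMk p C θ j v)) : φ = ψ := by
  refine LinearMap.ext fun m ↦ ?_
  obtain ⟨x, rfl⟩ := (indRel p kw G C θ j).mkQ_surjective m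
  induction x with
  | zero => simp only [map_zero]
  | add x y hx hy => simp only [map_add, hx, hy]
  | tmul u v =>
    rw [mkQ_tmul]
    induction u using MonoidAlgebra.induction_linear with
    | zero => simp only [zero_smul, map_zero]
    | add x y hx hy => simp only [add_smul, map_add, hx, hy]
    | single g a =>
      have : MonoidAlgebra.single g a = a • MonoidAlgebra.single g (1 : ZMod p) := by simp
      rw [this, smul_assoc, φ.map_smul, ψ.map_smul, h]

/-- The pairing of `T^*` with `M(j)` attached to a functional on `T^* ⊗ M(j)`. -/
noncomputable def balPairing (F : Dual kbar (balTensor p kw kbar G C θ j T)) :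
    Dual kbar T →ₗ[kbar] inducedMj p kw G C θ j →ₗ[ZMod p] kbar :=
  TensorProduct.AlgebraTensorModule.curry (F ∘ₗ (balRel p kw kbar G C θ j T).mkQ)

lemma balPairing_add (F F' : Dual kbar (balTensor p kw kbar G C θ j T)) :
    balPairing (F + F') = balPairing F + balPairing F' := rfl

lemma balPairing_smul (a : kbar) (F : Dual kbar (balTensor p kw kbar G C θ j T)) :
    balPairing (a • F) = a • balPairing F := rfl

lemma balPairing_injective {F : Dual kbar (balTensor p kw kbar G C θ j T)}
    (h : balPairing F = 0) : F = 0 :=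
  Submodule.linearMap_qext _ (TensorProduct.AlgebraTensorModule.curry_injective h)

lemma balPairing_move (F : Dual kbar (balTensor p kw kbar G C θ j T)) (fd : Dual kbar T)
    (m : inducedMj p kw G C θ j) (g : G) :
    balPairing F fd (MonoidAlgebra.single g (1 : ZMod p) • m)
      = balPairing F (fd ∘ₗ grpSmul kbar G T g) m := by
  refine congrArg F (Eq.symm ?_)
  change (balRel p kw kbar G C θ j T).mkQ _ = (balRel p kw kbar G C θ j T).mkQ _
  rw [← sub_eq_zero, ← map_sub, Submodule.mkQ_apply, Submodule.Quotient.mk_eq_zero]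
  exact Submodule.subset_span ⟨fd, m, g, rfl⟩

/-- A functional on `T^* ⊗ M(j)` yields an `𝔽_p`-linear map from `k_w` to the bidual of `T`. -/
noncomputable def bidualMap : Dual kbar (balTensor p kw kbar G C θ j T) →ₗ[kbar]
    kw →ₗ[ZMod p] Dual kbar (Dual kbar T) where
  toFun F :=
    { toFun v :=
        { toFun fd := balPairing F fd (inducedMk p C θ j v)
          map_add' x y := by rw [map_add, LinearMap.add_apply]
          map_smul' a x := by rw [map_smul, LinearMap.smul_apply, RingHom.id_apply] }
      map_add' v w := by
        ext fd
        simp only [map_add, LinearMap.coe_mk, AddHom.coe_mk, LinearMap.add_apply]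
      map_smul' a v := by
        ext fd
        simp only [map_smul, LinearMap.coe_mk, AddHom.coe_mk, LinearMap.smul_apply,
          RingHom.id_apply] }
  map_add' F F' := by
    ext v fd
    simp only [balPairing_add, LinearMap.coe_mk, AddHom.coe_mk, LinearMap.add_apply]
  map_smul' a F := by
    ext v fd
    simp only [balPairing_smul, LinearMap.coe_mk, AddHom.coe_mk, LinearMap.smul_apply,
      RingHom.id_apply]

variable [Module (ZMod p) T] [IsScalarTower (ZMod p) kbar T]

variable (p kw kbar G C θ j T) in
/-- The `k̄`-space `Hom_{𝔽_p[C]}(V_j, T)` of `C`-equivariant `𝔽_p`-linear maps. -/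
noncomputable def equivariantHom : Submodule kbar (kw →ₗ[ZMod p] T) where
  carrier := {φ | ∀ (c : ↥C) (v : kw),
    grpSmul kbar G T (c : G) (φ v) = φ (((θ c ^ j : kwˣ) : kw) * v)}
  zero_mem' := by intro c v; simp
  add_mem' := by
    intro φ ψ hφ hψ c v
    simp [hφ c v, hψ c v]
  smul_mem' := by
    intro a φ hφ c v
    simp [hφ c v]

variable [FiniteDimensional kbar T]

/-- The map `k_w → T` attached to a functional on `T^* ⊗ M(j)`. -/
noncomputable def dualToHom : Dual kbar (balTensor p kw kbar G C θ j T) →ₗ[kbar]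
    kw →ₗ[ZMod p] T where
  toFun F := ((evalEquiv kbar T).symm.toLinearMap.restrictScalars (ZMod p)) ∘ₗ bidualMap F
  map_add' F F' := by ext; simp
  map_smul' a F := by ext; simp

lemma dual_dualToHom (F : Dual kbar (balTensor p kw kbar G C θ j T)) (fd : Dual kbar T) (v : kw) :
    fd (dualToHom F v) = balPairing F fd (inducedMk p C θ j v) := by
  change fd ((evalEquiv kbar T).symm (bidualMap F v)) = bidualMap F v fd
  simp

lemma dualToHom_injective : Function.Injective
    (dualToHom : Dual kbar (balTensor p kw kbar G C θ j T) →ₗ[kbar] kw →ₗ[ZMod p] T) := by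
  rw [injective_iff_map_eq_zero]
  intro F hF
  refine balPairing_injective (LinearMap.ext fun fd ↦ inducedMj_hom_ext fun g v ↦ ?_)
  rw [balPairing_move, ← dual_dualToHom, hF, LinearMap.zero_apply, map_zero,
    LinearMap.zero_apply, LinearMap.zero_apply]

lemma dualToHom_mem (F : Dual kbar (balTensor p kw kbar G C θ j T)) :
    dualToHom F ∈ equivariantHom p kw kbar G C θ j T := by
  intro c v
  rw [← sub_eq_zero, ← Module.forall_dual_apply_eq_zero_iff kbar]
  intro fd
  rw [map_sub, sub_eq_zero, ← LinearMap.comp_apply, dual_dualToHom, dual_dualToHom,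
    ← single_smul_inducedMk, balPairing_move]

/-- The `𝔽_p[G]`-linear map `M(j) → T` extending an equivariant map `k_w → T`. -/
noncomputable def inducedLift [Module (MonoidAlgebra (ZMod p) G) T]
    [IsScalarTower (ZMod p) (MonoidAlgebra (ZMod p) G) T]
    (hT : ∀ (g : G) (t : T), MonoidAlgebra.single g (1 : ZMod p) • t = grpSmul kbar G T g t)
    (φ : equivariantHom p kw kbar G C θ j T) :
    inducedMj p kw G C θ j →ₗ[MonoidAlgebra (ZMod p) G] T :=
  (indRel p kw G C θ j).liftQ
    (TensorProduct.AlgebraTensorModule.lift (LinearMap.toSpanSingleton _ _ φ.1)) (by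
      rw [indRel, Submodule.span_le]
      rintro _ ⟨u, c, v, rfl⟩
      simp [mul_smul, hT, φ.2 c v])

lemma exists_dualToHom_eq [Module (MonoidAlgebra (ZMod p) G) T]
    [IsScalarTower (ZMod p) (MonoidAlgebra (ZMod p) G) T]
    (hT : ∀ (g : G) (t : T), MonoidAlgebra.single g (1 : ZMod p) • t = grpSmul kbar G T g t)
    (φ : equivariantHom p kw kbar G C θ j T) :
    ∃ F : Dual kbar (balTensor p kw kbar G C θ j T), dualToHom F = φ.1 := by
  let L := (inducedLift hT φ).restrictScalars (ZMod p)
  let B : Dual kbar T →ₗ[kbar] inducedMj p kw G C θ j →ₗ[ZMod p] kbar :=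
    { toFun fd := fd.restrictScalars (ZMod p) ∘ₗ L
      map_add' _ _ := rfl
      map_smul' _ _ := rfl }
  refine ⟨(balRel p kw kbar G C θ j T).liftQ (TensorProduct.AlgebraTensorModule.lift B) ?_, ?_⟩
  · rw [balRel, Submodule.span_le]
    rintro _ ⟨fd, m, g, rfl⟩
    have : grpSmul kbar G T g (L m) = L (MonoidAlgebra.single g (1 : ZMod p) • m) :=
      (hT g _).symm.trans ((inducedLift hT φ).map_smul _ m).symm
    rw [SetLike.mem_coe, LinearMap.mem_ker, map_sub, sub_eq_zero]
    exact congrArg fd this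
  · ext v
    rw [← sub_eq_zero, ← Module.forall_dual_apply_eq_zero_iff kbar]
    intro fd
    rw [map_sub, sub_eq_zero, dual_dualToHom]
    exact congrArg fd (one_smul _ _)

lemma finrank_balTensor [Module (MonoidAlgebra (ZMod p) G) T]
    [IsScalarTower (ZMod p) (MonoidAlgebra (ZMod p) G) T]
    (hT : ∀ (g : G) (t : T), MonoidAlgebra.single g (1 : ZMod p) • t = grpSmul kbar G T g t) :
    finrank kbar (balTensor p kw kbar G C θ j T)
      = finrank kbar (equivariantHom p kw kbar G C θ j T) := by
  rw [← Subspace.dual_finrank_eq]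
  refine (LinearEquiv.ofBijective (dualToHom.codRestrict _ dualToHom_mem)
    ⟨fun F F' h ↦ dualToHom_injective (congrArg Subtype.val h), fun φ ↦ ?_⟩).finrank_eq
  obtain ⟨F, hF⟩ := exists_dualToHom_eq hT φ
  exact ⟨F, Subtype.ext hF⟩

end BalancedDual

section Frobenius

variable (p : ℕ) [Fact (Nat.Prime p)]
  (kw : Type) [Field kw] [Finite kw] [Algebra (ZMod p) kw]
  (kbar : Type) [Field kbar] [Algebra kw kbar]
  [Algebra (ZMod p) kbar] [IsScalarTower (ZMod p) kw kbar]
  (T : Type) [AddCommGroup T] [Module kbar T] [Module (ZMod p) T] [IsScalarTower (ZMod p) kbar T]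

/-- The `a`-th power of Frobenius on `k_w`, followed by the inclusion `k_w ⊆ k̄`. -/
noncomputable def frobeniusEmb (a : ℕ) : kw →ₐ[ZMod p] kbar :=
  (IsScalarTower.toAlgHom (ZMod p) kw kbar).comp (FiniteField.frobeniusAlgHom (ZMod p) kw ^ a)

omit [Finite kw] in
lemma frobeniusEmb_apply (a : ℕ) (v : kw) :
    frobeniusEmb p kw kbar a v = algebraMap kw kbar (v ^ p ^ a) := by
  simp [frobeniusEmb, AlgHom.coe_pow, FiniteField.coe_frobeniusAlgHom, pow_iterate, ZMod.card]

lemma linearIndependent_frobeniusEmb :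
    LinearIndependent kbar
      fun (a : Fin (finrank (ZMod p) kw)) (v : kw) ↦ frobeniusEmb p kw kbar a v := by
  have hinj : Function.Injective fun a : Fin (finrank (ZMod p) kw) ↦
      (frobeniusEmb p kw kbar a : kw →* kbar) := by
    intro a b h
    apply (FiniteField.bijective_frobeniusAlgHom_pow (ZMod p) kw).1
    ext v
    exact (algebraMap kw kbar).injective (DFunLike.congr_fun h v)
  exact (linearIndependent_monoidHom kw kbar).comp _ hinj

/-- The map sending `(t_a)` to `v ↦ ∑ v^{p^a} t_a`. -/
noncomputable def frobeniusSum :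
    (Fin (finrank (ZMod p) kw) → T) →ₗ[kbar] kw →ₗ[ZMod p] T where
  toFun t := ∑ a : Fin (finrank (ZMod p) kw), (frobeniusEmb p kw kbar a).toLinearMap.smulRight (t a)
  map_add' s t := by ext; simp [Finset.sum_add_distrib]
  map_smul' c t := by ext; simp [Finset.smul_sum, smul_comm c]

omit [Finite kw] in
lemma frobeniusSum_apply (t : Fin (finrank (ZMod p) kw) → T) (v : kw) :
    frobeniusSum p kw kbar T t v = ∑ a : Fin (finrank (ZMod p) kw), frobeniusEmb p kw kbar a v • t a := by
  simp [frobeniusSum]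

lemma frobeniusSum_injective : Function.Injective (frobeniusSum p kw kbar T) := by
  rw [injective_iff_map_eq_zero]
  intro t ht
  ext a
  rw [Pi.zero_apply, ← Module.forall_dual_apply_eq_zero_iff kbar]
  intro fd
  refine Fintype.linearIndependent_iff.1 (linearIndependent_frobeniusEmb p kw kbar)
    (fun a ↦ fd (t a)) ?_ a
  funext v
  have := congrArg fd (DFunLike.congr_fun ht v)
  rw [frobeniusSum_apply] at this
  simpa [Finset.sum_apply, mul_comm] using this

lemma frobeniusSum_surjective [FiniteDimensional kbar T] :
    Function.Surjective (frobeniusSum p kw kbar T) := by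
  let e := (finBasis (ZMod p) kw).constr kbar (M' := T)
  have := Module.Finite.equiv e
  exact (LinearMap.injective_iff_surjective_of_finrank_eq_finrank e.finrank_eq).1
    (frobeniusSum_injective p kw kbar T)

variable {p kw kbar T}
variable {G : Type} [Group G] {C : Subgroup G} {θ : ↥C →* kwˣ} {j : ℤ}
  [Module (MonoidAlgebra kbar G) T] [IsScalarTower kbar (MonoidAlgebra kbar G) T]

lemma frobeniusSum_mem_equivariantHom_iff (t : Fin (finrank (ZMod p) kw) → T) :
    frobeniusSum p kw kbar T t ∈ equivariantHom p kw kbar G C θ j T ↔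
      ∀ a : Fin (finrank (ZMod p) kw), t a ∈ eigensp kw kbar G C θ (j * (p : ℤ) ^ (a : ℕ)) T := by
  have hl (c : ↥C) (v : kw) : grpSmul kbar G T c (frobeniusSum p kw kbar T t v)
      = frobeniusSum p kw kbar T (fun a ↦ grpSmul kbar G T c (t a)) v := by
    simp [frobeniusSum_apply]
  have hr (c : ↥C) (v : kw) :
      frobeniusSum p kw kbar T t (((θ c ^ j : kwˣ) : kw) * v) = frobeniusSum p kw kbar T
        (fun a : Fin (finrank (ZMod p) kw) ↦
          algebraMap kw kbar ((θ c ^ (j * (p : ℤ) ^ (a : ℕ)) : kwˣ) : kw) • t a) v := by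
    simp only [frobeniusSum_apply]
    refine Finset.sum_congr rfl fun a _ ↦ ?_
    have : (θ c ^ (j * (p : ℤ) ^ (a : ℕ)) : kwˣ) = (θ c ^ j) ^ (p ^ (a : ℕ)) := by
      rw [zpow_mul, ← zpow_natCast, Nat.cast_pow]
    rw [this, smul_smul, map_mul, mul_comm, frobeniusEmb_apply p kw kbar a (θ c ^ j : kwˣ),
      Units.val_pow_eq_pow_val]
  refine ⟨fun h a c ↦ ?_, fun h c v ↦ ?_⟩
  · have heq := frobeniusSum_injective p kw kbar T
      (LinearMap.ext fun v ↦ (hl c v).symm.trans ((h c v).trans (hr c v)))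
    exact congrFun heq a
  · rw [hl, hr]
    congr 2
    ext a
    exact h a c

lemma finrank_equivariantHom [FiniteDimensional kbar T] :
    finrank kbar (equivariantHom p kw kbar G C θ j T)
      = ∑ a ∈ Finset.range (finrank (ZMod p) kw),
          finrank kbar (eigensp kw kbar G C θ (j * (p : ℤ) ^ a) T) := by
  rw [← Fin.sum_univ_eq_sum_range
    fun a ↦ finrank kbar (eigensp kw kbar G C θ (j * (p : ℤ) ^ a) T), ← finrank_pi_fintype]
  let E (a : Fin (finrank (ZMod p) kw)) := eigensp kw kbar G C θ (j * (p : ℤ) ^ (a : ℕ)) T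
  let Φ : (∀ a, E a) →ₗ[kbar] kw →ₗ[ZMod p] T :=
    frobeniusSum p kw kbar T ∘ₗ LinearMap.pi fun a ↦ (E a).subtype ∘ₗ LinearMap.proj a
  refine (LinearEquiv.ofBijective (Φ.codRestrict (equivariantHom p kw kbar G C θ j T) fun t ↦
    (frobeniusSum_mem_equivariantHom_iff _).2 fun a ↦ (t a).2)
    ⟨fun s t h ↦ ?_, fun φ ↦ ?_⟩).symm.finrank_eq
  · have := frobeniusSum_injective p kw kbar T (congrArg Subtype.val h)
    ext a
    exact congrFun this a
  · obtain ⟨t, ht⟩ := frobeniusSum_surjective p kw kbar T φ.1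
    have hmem := (frobeniusSum_mem_equivariantHom_iff t).1 (ht ▸ φ.2)
    exact ⟨fun a ↦ ⟨t a, hmem a⟩, Subtype.ext ht⟩

end Frobenius

/- STATEMENT 10:
Let `p` be a prime, `k_w` a finite field of characteristic `p` with `[k_w : 𝔽_p] = f`, and
`k̄` an algebraic closure of `k_w`.  Let `G` be a finite group, `C ≤ G` a cyclic subgroup of
order prime to `p`, `θ : C → k_wˣ` a group homomorphism, and `j` an integer.  With
`M(j) := 𝔽_p[G] ⊗_{𝔽_p[C]} V_j` and `T` a finite-dimensional `k̄`-linear representation of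
`G`, one has `dim_{k̄}( T^* ⊗_{𝔽_p[G]} M(j) ) = Σ_{a=0}^{f−1} dim_{k̄} T[θ^{j·p^a}]`. -/
theorem stmt10 (p : ℕ) [Fact (Nat.Prime p)]
    (kw : Type) [Field kw] [Finite kw] [CharP kw p] [Algebra (ZMod p) kw]
    (f : ℕ) (hf : Module.finrank (ZMod p) kw = f)
    (kbar : Type) [Field kbar] [Algebra kw kbar] [IsAlgClosure kw kbar]
    [Algebra (ZMod p) kbar] [IsScalarTower (ZMod p) kw kbar]
    (G : Type) [Group G] [Finite G] (C : Subgroup G) [IsCyclic ↥C]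
    (hC : ¬ p ∣ Nat.card ↥C)
    (θ : ↥C →* kwˣ) (j : ℤ)
    (T : Type) [AddCommGroup T] [Module kbar T] [Module (MonoidAlgebra kbar G) T]
    [IsScalarTower kbar (MonoidAlgebra kbar G) T] [FiniteDimensional kbar T] :
    Module.finrank kbar (balTensor p kw kbar G C θ j T)
      = ∑ a ∈ Finset.range f,
          Module.finrank kbar (eigensp kw kbar G C θ (j * (p : ℤ) ^ a) T) := by
  subst hf
  let : Module (ZMod p) T := Module.compHom T (algebraMap (ZMod p) kbar)
  have : IsScalarTower (ZMod p) kbar T := ⟨fun a b t ↦ by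
    rw [Algebra.smul_def, mul_smul]; rfl⟩
  let : Module (MonoidAlgebra (ZMod p) G) T :=
    Module.compHom T (MonoidAlgebra.mapRingHom G (algebraMap (ZMod p) kbar))
  have hsmul (u : MonoidAlgebra (ZMod p) G) (t : T) :
      u • t = MonoidAlgebra.mapRingHom G (algebraMap (ZMod p) kbar) u • t := rfl
  have : IsScalarTower (ZMod p) (MonoidAlgebra (ZMod p) G) T := ⟨fun a u t ↦ by
    rw [hsmul, hsmul, Algebra.smul_def, map_mul, mul_smul, ← algebraMap_smul kbar a,
      ← algebraMap_smul (MonoidAlgebra kbar G) (algebraMap (ZMod p) kbar a)]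
    congr 1
    exact DFunLike.congr_fun
      (MonoidAlgebra.mapRingHom_comp_algebraMap (algebraMap (ZMod p) kbar)) a⟩
  rw [finrank_balTensor fun g t ↦ ?_, finrank_equivariantHom]
  rw [hsmul]
  simp [grpSmul]
end

section
/- Let p ≥ 5 be a prime and let E be the elliptic curve over 𝔽_p defined by the Weierstrass equation y² = x³ − 1 (its discriminant −432 is nonzero in 𝔽_p). Then E(𝔽_p) contains no element of order p. -/
/-- The Weierstrass curve `y² = x³ − 1` over `𝔽_p = ZMod p`. -/
def cubicCurve (p : ℕ) : WeierstrassCurve.Affine (ZMod p) :=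
  { a₁ := 0, a₂ := 0, a₃ := 0, a₄ := 0, a₆ := -1 }

/-- An element of a field has at most two square roots. -/
theorem card_sqrt_le_two {F : Type*} [Field F] [Fintype F] [DecidableEq F] (c : F) :
    Fintype.card {y : F // y ^ 2 = c} ≤ 2 := by
  rw [Fintype.card_subtype]
  rcases (Finset.univ.filter fun y : F => y ^ 2 = c).eq_empty_or_nonempty with h | ⟨y, hy⟩
  · simp [h]
  · refine (Finset.card_le_card (t := {y, -y}) fun z hz => ?_).trans Finset.card_le_two
    simp only [Finset.mem_filter, Finset.mem_univ, true_and] at hy hz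
    simpa using sq_eq_sq_iff_eq_or_eq_neg.mp (hz.trans hy.symm)

theorem card_sqrt_zero_le_one {F : Type*} [Field F] [Fintype F] [DecidableEq F] :
    Fintype.card {y : F // y ^ 2 = 0} ≤ 1 := by
  rw [Fintype.card_le_one_iff]
  rintro ⟨y, hy⟩ ⟨z, hz⟩
  rw [Subtype.mk.injEq, eq_zero_of_pow_eq_zero hy, eq_zero_of_pow_eq_zero hz]

/-- Over a finite field of odd characteristic, some `x ≠ 1` carries at most one point of
`y² = x³ - 1`. -/
theorem exists_ne_one_card_sqrt_le_one {F : Type*} [Field F] [Fintype F] [DecidableEq F]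
    (hF : ringChar F ≠ 2) :
    ∃ x : F, x ≠ 1 ∧ Fintype.card {y : F // y ^ 2 = x ^ 3 - 1} ≤ 1 := by
  by_cases hinj : Function.Injective fun x : F => x ^ 3
  · obtain ⟨n, hn⟩ := FiniteField.exists_nonsquare hF
    obtain ⟨u, hu⟩ := (Finite.injective_iff_surjective.mp hinj) (1 + n)
    have hu : u ^ 3 - 1 = n := by linear_combination hu
    refine ⟨u, ?_, ?_⟩
    · rintro rfl
      exact hn ⟨0, by linear_combination -hu⟩
    · rw [Fintype.card_le_one_iff]
      rintro ⟨y, hy⟩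
      exact (hn ⟨y, by rw [← hu, ← hy, sq]⟩).elim
  · simp only [Function.Injective, not_forall] at hinj
    obtain ⟨a, b, hab, hne⟩ := hinj
    have hb : b ≠ 0 := by
      rintro rfl
      exact hne (by simpa using hab)
    refine ⟨a / b, fun h => hne ((div_eq_one_iff_eq hb).mp h), ?_⟩
    have h : (a / b) ^ 3 - 1 = 0 := by
      rw [div_pow, hab, div_self (pow_ne_zero 3 hb), sub_self]
    simpa only [h] using card_sqrt_zero_le_one (F := F)

theorem card_sq_eq_cube_sub_one_add_two_le {F : Type*} [Field F] [Fintype F] [DecidableEq F]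
    (hF : ringChar F ≠ 2) :
    Fintype.card (Σ x : F, {y : F // y ^ 2 = x ^ 3 - 1}) + 2 ≤ 2 * Fintype.card F := by
  obtain ⟨u, hu, hcard⟩ := exists_ne_one_card_sqrt_le_one hF
  have h_sum : ∑ x : F, (Fintype.card {y : F // y ^ 2 = x ^ 3 - 1} +
      ((if x = 1 then 1 else 0) + (if x = u then 1 else 0))) ≤ ∑ _x : F, 2 := by
    refine Finset.sum_le_sum fun x _ => ?_
    by_cases h1 : x = 1
    · subst h1
      simp [hu.symm]
    · by_cases h2 : x = u
      · subst h2
        simpa [h1] using hcard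
      · simp [h1, h2, card_sqrt_le_two]
  simp only [Finset.sum_add_distrib, Finset.sum_ite_eq', Finset.mem_univ, if_true,
    Finset.sum_const, Finset.card_univ, smul_eq_mul] at h_sum
  rw [Fintype.card_sigma]
  omega

theorem cubicCurve_equation_iff {p : ℕ} (x y : ZMod p) :
    (cubicCurve p).Equation x y ↔ y ^ 2 = x ^ 3 - 1 := by
  rw [WeierstrassCurve.Affine.equation_iff]
  simp [cubicCurve, sub_eq_add_neg]

theorem cubicCurve_Δ (p : ℕ) : (cubicCurve p).Δ = -432 := by
  simp only [cubicCurve, WeierstrassCurve.Δ, WeierstrassCurve.b₂, WeierstrassCurve.b₄,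
    WeierstrassCurve.b₆, WeierstrassCurve.b₈]
  ring

theorem cubicCurve_Δ_ne_zero (p : ℕ) [hpr : Fact p.Prime] (hp : 5 ≤ p) :
    (cubicCurve p).Δ ≠ 0 := by
  rw [cubicCurve_Δ, neg_ne_zero]
  intro h
  have hdvd : p ∣ 2 ^ 4 * 3 ^ 3 := (ZMod.natCast_eq_zero_iff _ p).mp (by push_cast; linear_combination h)
  rcases hpr.out.dvd_mul.mp hdvd with h2 | h3
  · have := Nat.le_of_dvd two_pos (hpr.out.dvd_of_dvd_pow h2)
    omega
  · have := Nat.le_of_dvd three_pos (hpr.out.dvd_of_dvd_pow h3)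
    omega

/-- The coordinates of a point of `cubicCurve p`, with `none` for the point at infinity. -/
def cubicCurveCoords {p : ℕ} [Fact p.Prime] :
    (cubicCurve p).Point → Option (Σ x : ZMod p, {y : ZMod p // y ^ 2 = x ^ 3 - 1})
  | .zero => none
  | .some x y h => some ⟨x, y, (cubicCurve_equation_iff x y).mp h.1⟩

theorem cubicCurveCoords_injective {p : ℕ} [Fact p.Prime] :
    Function.Injective (cubicCurveCoords (p := p)) := by
  rintro (_ | ⟨x, y, h⟩) (_ | ⟨x', y', h'⟩) heq
  · rfl
  · simp [cubicCurveCoords] at heq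
  · simp [cubicCurveCoords] at heq
  · simp only [cubicCurveCoords, Option.some.injEq, Sigma.mk.injEq] at heq
    obtain ⟨rfl, heq⟩ := heq
    simpa using heq

instance {p : ℕ} [Fact p.Prime] : Finite (cubicCurve p).Point :=
  Finite.of_injective _ cubicCurveCoords_injective

theorem natCard_cubicCurve_point_lt (p : ℕ) [Fact p.Prime] (hp : p ≠ 2) :
    Nat.card (cubicCurve p).Point < 2 * p := by
  have hle := Nat.card_le_card_of_injective _ (cubicCurveCoords_injective (p := p))
  have hcard := card_sq_eq_cube_sub_one_add_two_le (F := ZMod p) (by rwa [ZMod.ringChar_zmod_n])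
  rw [Finite.card_option, Nat.card_eq_fintype_card (α := Σ _, _)] at hle
  rw [ZMod.card] at hcard
  omega

theorem two_dvd_natCard_cubicCurve_point (p : ℕ) [Fact p.Prime] (hp : 5 ≤ p) :
    2 ∣ Nat.card (cubicCurve p).Point := by
  have hns : (cubicCurve p).Nonsingular 1 0 :=
    (WeierstrassCurve.Affine.equation_iff_nonsingular_of_Δ_ne_zero
      (cubicCurve_Δ_ne_zero p hp)).mp ((cubicCurve_equation_iff 1 0).mpr (by simp))
  have horder : addOrderOf (WeierstrassCurve.Affine.Point.some 1 0 hns) = 2 := by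
    refine addOrderOf_eq_prime ?_ (WeierstrassCurve.Affine.Point.some_ne_zero hns)
    rw [two_nsmul]
    exact WeierstrassCurve.Affine.Point.add_self_of_Y_eq
      (by simp [WeierstrassCurve.Affine.negY, cubicCurve])
  exact horder ▸ addOrderOf_dvd_natCard _

/- STATEMENT 15:
Let `p ≥ 5` be a prime and let `E` be the elliptic curve over `𝔽_p` defined by the Weierstrass
equation `y² = x³ − 1` (its discriminant `−432` is nonzero in `𝔽_p`).  Then `E(𝔽_p)` contains
no element of order `p`. -/
theorem stmt15 (p : ℕ) [Fact (Nat.Prime p)] (hp : 5 ≤ p) :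
    (cubicCurve p).Δ = -432 ∧ (cubicCurve p).Δ ≠ 0 ∧
    ∀ P : (cubicCurve p).Point, addOrderOf P ≠ p := by
  refine ⟨cubicCurve_Δ p, cubicCurve_Δ_ne_zero p hp, fun P hP => ?_⟩
  have hcop : Nat.Coprime 2 p :=
    (Nat.coprime_primes Nat.prime_two Fact.out).mpr (by omega)
  have hdvd := hcop.mul_dvd_of_dvd_of_dvd (two_dvd_natCard_cubicCurve_point p hp)
    (hP.symm.dvd.trans (addOrderOf_dvd_natCard P))
  exact (Nat.le_of_dvd Nat.card_pos hdvd).not_gt (natCard_cubicCurve_point_lt p (by omega))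
end
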